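/- Let μ ∈ ℂ with Re μ < 1/2 and ν ∈ (−1/2, −Re μ). For g ∈ L₁(ℝ), the adjoint index transform (G_μ g)(x) = ∫_ℝ Φ_τ(x) g(τ) dτ converges absolutely for every x > 0, and ess sup_{x>0} |x^ν (G_μ g)(x)| ≤ C_{μ,ν} ‖g‖_{L₁(ℝ)}, where C_{μ,ν} = (2^{2ν−1}/(π√π)) B(ν+1/2, ν+1/2) ∫_{−∞}^∞ |Γ(ν+1/2+it)² Γ(−μ−ν−it) / Γ(1+ν+it−μ)| dt and B denotes the Euler Beta function. -/

import Mathlib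

open MeasureTheory Set Complex

/-- The integrand of the Mellin–Barnes representation of the kernel `Φ_τ`. -/
noncomputable def Kker (μ : ℂ) (τ : ℝ) (s : ℂ) : ℂ :=
  Complex.Gamma (s + 1/2 + Complex.I * (τ : ℂ)) *
    Complex.Gamma (s + 1/2 - Complex.I * (τ : ℂ)) *
    Complex.Gamma (s + 1/2) * Complex.Gamma (-μ - s) /
    (Complex.Gamma (1 + s) * Complex.Gamma (1 + s - μ))

/-- The kernel `Φ_τ(x)`, given as a Mellin–Barnes integral along the line `Re s = γ`. -/
noncomputable def Phi (μ : ℂ) (γ τ x : ℝ) : ℂ :=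
  (1 / (2 * Real.pi)) •
    ∫ t : ℝ, Kker μ τ ((γ : ℂ) + (t : ℂ) * Complex.I) *
      (x : ℂ) ^ (-((γ : ℂ) + (t : ℂ) * Complex.I))

/-- The constant `C_{μ,ν}` with the Euler Beta function `B(a,b) = Γ(a)Γ(b)/Γ(a+b)`. -/
noncomputable def Cconst (μ : ℂ) (ν : ℝ) : ℝ :=
  (2 : ℝ) ^ (2 * ν - 1) / (Real.pi * Real.sqrt Real.pi) *
    (Real.Gamma (ν + 1/2) * Real.Gamma (ν + 1/2) / Real.Gamma (ν + 1/2 + (ν + 1/2))) *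
    ∫ t : ℝ, ‖Complex.Gamma ((ν : ℂ) + 1/2 + (t : ℂ) * Complex.I) ^ 2 *
      Complex.Gamma (-μ - (ν : ℂ) - (t : ℂ) * Complex.I) /
      Complex.Gamma (1 + (ν : ℂ) + (t : ℂ) * Complex.I - μ)‖

/-- The adjoint index transform `(G_μ g)(x) = ∫_ℝ Φ_τ(x) g(τ) dτ`. -/
noncomputable def Gmu (μ : ℂ) (γ : ℝ) (g : ℝ → ℂ) (x : ℝ) : ℂ :=
  ∫ τ : ℝ, Phi μ γ τ x * g τ

theorem norm_Gamma_le_Gamma_re {s : ℂ} (hs : 0 < s.re) :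
    ‖Complex.Gamma s‖ ≤ Real.Gamma s.re := by
  rw [Complex.Gamma_eq_integral hs, Real.Gamma_eq_integral hs]
  refine (norm_integral_le_integral_norm _).trans_eq ?_
  refine setIntegral_congr_fun measurableSet_Ioi fun x hx => ?_
  simp only [norm_mul]
  rw [Complex.norm_cpow_eq_rpow_re_of_pos hx, Complex.norm_real, Real.norm_eq_abs,
    abs_of_pos (Real.exp_pos _)]
  simp

theorem norm_betaIntegral_le {u v : ℂ} (hu : 0 < u.re) (hv : 0 < v.re) :
    ‖Complex.betaIntegral u v‖ ≤
      Real.Gamma u.re * Real.Gamma v.re / Real.Gamma (u.re + v.re) := by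
  have key : Complex.betaIntegral (u.re : ℂ) (v.re : ℂ) =
      ((∫ x : ℝ in (0 : ℝ)..1, x ^ (u.re - 1) * (1 - x) ^ (v.re - 1) : ℝ) : ℂ) := by
    rw [Complex.betaIntegral, ← intervalIntegral.integral_ofReal]
    refine intervalIntegral.integral_congr fun x hx => ?_
    rw [uIcc_of_le zero_le_one] at hx
    have h1 : (0 : ℝ) ≤ 1 - x := by linarith [hx.2]
    simp only [Complex.ofReal_mul]
    rw [Complex.ofReal_cpow hx.1, Complex.ofReal_cpow h1]
    push_cast
    rfl
  have hval : ∫ x : ℝ in (0 : ℝ)..1, x ^ (u.re - 1) * (1 - x) ^ (v.re - 1) =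
      Real.Gamma u.re * Real.Gamma v.re / Real.Gamma (u.re + v.re) := by
    rw [Complex.betaIntegral_eq_Gamma_mul_div _ _ (by simpa using hu) (by simpa using hv)] at key
    rw [← Complex.ofReal_inj, ← key]
    push_cast [← Complex.Gamma_ofReal]
    rfl
  rw [← hval, Complex.betaIntegral, intervalIntegral.integral_of_le zero_le_one,
    intervalIntegral.integral_of_le zero_le_one, integral_Ioc_eq_integral_Ioo,
    integral_Ioc_eq_integral_Ioo]
  refine (norm_integral_le_integral_norm _).trans_eq ?_
  refine setIntegral_congr_fun measurableSet_Ioo fun x hx => ?_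
  have h1 : (0 : ℝ) < 1 - x := by linarith [hx.2]
  simp only [norm_mul]
  rw [Complex.norm_cpow_eq_rpow_re_of_pos hx.1, ← Complex.ofReal_one, ← Complex.ofReal_sub,
    Complex.norm_cpow_eq_rpow_re_of_pos h1]
  simp

theorem norm_Gamma_mul_Gamma_le {u v : ℂ} (hu : 0 < u.re) (hv : 0 < v.re) :
    ‖Complex.Gamma u * Complex.Gamma v‖ ≤ ‖Complex.Gamma (u + v)‖ *
      (Real.Gamma u.re * Real.Gamma v.re / Real.Gamma (u.re + v.re)) := by
  rw [Complex.Gamma_mul_Gamma_eq_betaIntegral hu hv, norm_mul]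
  exact mul_le_mul_of_nonneg_left (norm_betaIntegral_le hu hv) (norm_nonneg _)

/-- Quadratic decay of the Gamma function on vertical lines. -/
theorem norm_Gamma_mul_one_add_im_sq_le {z : ℂ} (hz : 0 < z.re) :
    ‖Complex.Gamma z‖ * (1 + z.im ^ 2) ≤ Real.Gamma z.re + Real.Gamma (z.re + 2) := by
  have hz0 : z ≠ 0 := by rintro rfl; simp at hz
  have hz1 : z + 1 ≠ 0 := by
    intro h
    have := congrArg Complex.re h
    simp at this
    linarith
  have hrec : Complex.Gamma (z + 1 + 1) = (z + 1) * (z * Complex.Gamma z) := by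
    rw [Complex.Gamma_add_one _ hz1, Complex.Gamma_add_one _ hz0]
  have h2 : ‖Complex.Gamma (z + 1 + 1)‖ ≤ Real.Gamma (z.re + 2) := by
    have := norm_Gamma_le_Gamma_re (s := z + 1 + 1) (by simp; linarith)
    rwa [show (z + 1 + 1).re = z.re + 2 by simp; ring] at this
  rw [hrec, norm_mul, norm_mul] at h2
  have h3 : |z.im| ≤ ‖z‖ := Complex.abs_im_le_norm z
  have h4 : |z.im| ≤ ‖z + 1‖ := by simpa using Complex.abs_im_le_norm (z + 1)
  have h5 : z.im ^ 2 ≤ ‖z + 1‖ * ‖z‖ := by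
    rw [← sq_abs, sq]
    exact mul_le_mul h4 h3 (abs_nonneg _) (norm_nonneg _)
  have h6 := mul_le_mul_of_nonneg_right h5 (norm_nonneg (Complex.Gamma z))
  linarith [norm_Gamma_le_Gamma_re hz]

theorem continuous_Gamma_comp {X : Type*} [TopologicalSpace X] {f : X → ℂ} (hf : Continuous f)
    (hpos : ∀ x, 0 < (f x).re) : Continuous fun x => Complex.Gamma (f x) := by
  refine continuous_iff_continuousAt.mpr fun x => ?_
  refine ContinuousAt.comp (g := Complex.Gamma) (Complex.continuousAt_Gamma _ fun m hm => ?_)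
    hf.continuousAt
  have := hpos x
  rw [hm] at this
  simp at this
  linarith [(Nat.cast_nonneg m : (0 : ℝ) ≤ m)]

/-- The integrand whose absolute value is integrated in `Cconst`. -/
noncomputable def constIntegrand (μ : ℂ) (ν t : ℝ) : ℂ :=
  Complex.Gamma ((ν : ℂ) + 1/2 + (t : ℂ) * Complex.I) ^ 2 *
    Complex.Gamma (-μ - (ν : ℂ) - (t : ℂ) * Complex.I) /
    Complex.Gamma (1 + (ν : ℂ) + (t : ℂ) * Complex.I - μ)

theorem continuous_constIntegrand {μ : ℂ} {ν : ℝ}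
    (hν : ν ∈ Set.Ioo (-(1/2) : ℝ) (-μ.re)) : Continuous (constIntegrand μ ν) := by
  obtain ⟨h1, h2⟩ := hν
  unfold constIntegrand
  have hc : ∀ t : ℝ, 0 < (1 + (ν : ℂ) + (t : ℂ) * Complex.I - μ).re := fun t => by
    simp; linarith
  refine Continuous.div (Continuous.mul (Continuous.pow (continuous_Gamma_comp (by fun_prop)
    fun t => ?_) 2) (continuous_Gamma_comp (by fun_prop) fun t => ?_))
    (continuous_Gamma_comp (by fun_prop) hc) fun t => Complex.Gamma_ne_zero_of_re_pos (hc t)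
  · simp; linarith
  · simp; linarith

theorem integrable_constIntegrand {μ : ℂ} {ν : ℝ}
    (hν : ν ∈ Set.Ioo (-(1/2) : ℝ) (-μ.re)) : Integrable (constIntegrand μ ν) := by
  have hcont := continuous_constIntegrand hν
  obtain ⟨h1, h2⟩ := hν
  set w : ℂ := 1/2 - μ with hw
  have hwre : 0 < w.re := by simp [hw]; linarith
  have hwG : 0 < ‖Complex.Gamma w‖ := norm_pos_iff.mpr (Complex.Gamma_ne_zero_of_re_pos hwre)
  set a : ℝ := ν + 1/2 with ha
  have ha0 : 0 < a := by linarith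
  set B : ℝ := Real.Gamma a * Real.Gamma w.re / Real.Gamma (a + w.re) with hB
  set D : ℝ := B / ‖Complex.Gamma w‖ * (Real.Gamma a + Real.Gamma (a + 2)) *
    Real.Gamma (-μ.re - ν) with hD
  refine (integrable_inv_one_add_sq.const_mul D).mono' hcont.aestronglyMeasurable
    (Filter.Eventually.of_forall fun t => ?_)
  set z : ℂ := (ν : ℂ) + 1/2 + (t : ℂ) * Complex.I with hz
  have hzre : z.re = a := by simp [hz, ha]
  have hzim : z.im = t := by simp [hz]
  set p : ℂ := -μ - (ν : ℂ) - (t : ℂ) * Complex.I with hp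
  have hpre : p.re = -μ.re - ν := by simp [hp]
  have hsum : 1 + (ν : ℂ) + (t : ℂ) * Complex.I - μ = z + w := by rw [hz, hw]; ring
  have hzw : 0 < ‖Complex.Gamma (z + w)‖ :=
    norm_pos_iff.mpr (Complex.Gamma_ne_zero_of_re_pos (by rw [Complex.add_re, hzre]; linarith))
  have hbeta := norm_Gamma_mul_Gamma_le (u := z) (v := w) (by rw [hzre]; exact ha0) hwre
  rw [hzre, ← hB, norm_mul] at hbeta
  have hratio : ‖Complex.Gamma z‖ / ‖Complex.Gamma (z + w)‖ ≤ B / ‖Complex.Gamma w‖ := by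
    rw [div_le_div_iff₀ hzw hwG]
    linarith
  have hdecay := norm_Gamma_mul_one_add_im_sq_le (z := z) (by rw [hzre]; exact ha0)
  rw [hzre, hzim] at hdecay
  have hdecay' : ‖Complex.Gamma z‖ ≤ (Real.Gamma a + Real.Gamma (a + 2)) * (1 + t ^ 2)⁻¹ := by
    rw [← div_eq_mul_inv, le_div_iff₀ (by positivity)]
    exact hdecay
  have hpG := norm_Gamma_le_Gamma_re (s := p) (by rw [hpre]; linarith)
  rw [hpre] at hpG
  have hB0 : 0 ≤ B / ‖Complex.Gamma w‖ := le_trans (by positivity) hratio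
  have hE0 := (norm_nonneg _).trans hdecay'
  calc ‖constIntegrand μ ν t‖
      = ‖Complex.Gamma z‖ / ‖Complex.Gamma (z + w)‖ * ‖Complex.Gamma z‖ * ‖Complex.Gamma p‖ := by
        rw [constIntegrand, ← hz, ← hp, hsum, norm_div, norm_mul, norm_pow]
        ring
    _ ≤ B / ‖Complex.Gamma w‖ * ((Real.Gamma a + Real.Gamma (a + 2)) * (1 + t ^ 2)⁻¹) *
          Real.Gamma (-μ.re - ν) := by
        gcongr
    _ = D * (1 + t ^ 2)⁻¹ := by rw [hD]; ring

/-- The factor in front of the integral in `Cconst`, multiplied by `2 * π`. -/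
noncomputable def kernelFactor (ν : ℝ) : ℝ :=
  (2 : ℝ) ^ (2 * ν) / Real.sqrt Real.pi *
    (Real.Gamma (ν + 1/2) * Real.Gamma (ν + 1/2) / Real.Gamma (ν + 1/2 + (ν + 1/2)))

theorem norm_Kker_le (μ : ℂ) {ν : ℝ} (hν : -(1/2) < ν) (τ t : ℝ) :
    ‖Kker μ τ ((ν : ℂ) + (t : ℂ) * Complex.I)‖ ≤ kernelFactor ν * ‖constIntegrand μ ν t‖ := by
  set s : ℂ := (ν : ℂ) + (t : ℂ) * Complex.I with hs
  have hsre : s.re = ν := by simp [hs]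
  set B : ℝ := Real.Gamma (ν + 1/2) * Real.Gamma (ν + 1/2) / Real.Gamma (ν + 1/2 + (ν + 1/2))
    with hB
  have hu : (s + 1/2 + Complex.I * (τ : ℂ)).re = ν + 1/2 := by simp [hsre]
  have hv : (s + 1/2 - Complex.I * (τ : ℂ)).re = ν + 1/2 := by simp [hsre]
  have hbeta := norm_Gamma_mul_Gamma_le (u := s + 1/2 + Complex.I * (τ : ℂ))
    (v := s + 1/2 - Complex.I * (τ : ℂ)) (by rw [hu]; linarith) (by rw [hv]; linarith)
  rw [hu, hv, ← hB,
    show s + 1/2 + Complex.I * (τ : ℂ) + (s + 1/2 - Complex.I * (τ : ℂ)) = 2 * (s + 1/2) by ring]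
    at hbeta
  have hdup := congrArg norm (Complex.Gamma_mul_Gamma_add_half (s + 1/2))
  have hexp : (1 - 2 * (s + 1/2)).re = -(2 * ν) := by simp [hsre]; ring
  have h2 : ‖(2 : ℂ) ^ (1 - 2 * (s + 1/2))‖ = (2 : ℝ) ^ (-(2 * ν)) := by
    have := Complex.norm_cpow_eq_rpow_re_of_pos (x := 2) two_pos (1 - 2 * (s + 1/2))
    rw [hexp] at this
    exact_mod_cast this
  rw [norm_mul, norm_mul, norm_mul, h2, Complex.norm_real, Real.norm_eq_abs,
    abs_of_nonneg (Real.sqrt_nonneg _), show s + 1/2 + 1/2 = 1 + s by ring,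
    Real.rpow_neg two_pos.le] at hdup
  have hpow : (0 : ℝ) < 2 ^ (2 * ν) := Real.rpow_pos_of_pos two_pos _
  have hpi : 0 < Real.sqrt Real.pi := Real.sqrt_pos.mpr Real.pi_pos
  have h1s : 0 < ‖Complex.Gamma (1 + s)‖ :=
    norm_pos_iff.mpr (Complex.Gamma_ne_zero_of_re_pos (by simp [hsre]; linarith))
  have hdup' : ‖Complex.Gamma (2 * (s + 1/2))‖ =
      2 ^ (2 * ν) / Real.sqrt Real.pi * ‖Complex.Gamma (s + 1/2)‖ * ‖Complex.Gamma (1 + s)‖ := by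
    field_simp at hdup ⊢
    linarith
  have hF : ‖constIntegrand μ ν t‖ = ‖Complex.Gamma (s + 1/2)‖ ^ 2 * ‖Complex.Gamma (-μ - s)‖ /
      ‖Complex.Gamma (1 + s - μ)‖ := by
    rw [constIntegrand, norm_div, norm_mul, norm_pow, hs, add_right_comm (ν : ℂ), sub_sub,
      add_assoc 1]
  rw [hdup'] at hbeta
  calc ‖Kker μ τ s‖
      = ‖Complex.Gamma (s + 1/2 + Complex.I * (τ : ℂ)) *
          Complex.Gamma (s + 1/2 - Complex.I * (τ : ℂ))‖ *
        (‖Complex.Gamma (s + 1/2)‖ * ‖Complex.Gamma (-μ - s)‖ /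
          (‖Complex.Gamma (1 + s)‖ * ‖Complex.Gamma (1 + s - μ)‖)) := by
        rw [Kker]
        simp only [norm_div, norm_mul]
        ring
    _ ≤ 2 ^ (2 * ν) / Real.sqrt Real.pi * ‖Complex.Gamma (s + 1/2)‖ * ‖Complex.Gamma (1 + s)‖ * B *
        (‖Complex.Gamma (s + 1/2)‖ * ‖Complex.Gamma (-μ - s)‖ /
          (‖Complex.Gamma (1 + s)‖ * ‖Complex.Gamma (1 + s - μ)‖)) := by
        gcongr
    _ = kernelFactor ν * ‖constIntegrand μ ν t‖ := by
        rw [hF, kernelFactor, ← hB]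
        field_simp

theorem norm_Phi_le {μ : ℂ} {ν : ℝ}
    (hν : ν ∈ Set.Ioo (-(1/2) : ℝ) (-μ.re)) (τ : ℝ) {x : ℝ} (hx : 0 < x) :
    ‖Phi μ ν τ x‖ ≤ x ^ (-ν) * Cconst μ ν := by
  have hint : Integrable fun t => kernelFactor ν * ‖constIntegrand μ ν t‖ * x ^ (-ν) :=
    ((integrable_constIntegrand hν).norm.const_mul _).mul_const _
  have hle := norm_integral_le_of_norm_le
    (f := fun t : ℝ => Kker μ τ ((ν : ℂ) + (t : ℂ) * Complex.I) *
      (x : ℂ) ^ (-((ν : ℂ) + (t : ℂ) * Complex.I))) hint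
    (Filter.Eventually.of_forall fun t => by
      rw [norm_mul, Complex.norm_cpow_eq_rpow_re_of_pos hx,
        show (-((ν : ℂ) + (t : ℂ) * Complex.I)).re = -ν by simp]
      exact mul_le_mul_of_nonneg_right (norm_Kker_le μ hν.1 τ t) (Real.rpow_nonneg hx.le _))
  rw [integral_mul_const, integral_const_mul] at hle
  have hpi := Real.pi_pos
  have hpi2 : 0 < Real.sqrt Real.pi := Real.sqrt_pos.mpr hpi
  have hC : Cconst μ ν = 1 / (2 * Real.pi) * (kernelFactor ν * ∫ t, ‖constIntegrand μ ν t‖) := by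
    rw [Cconst, kernelFactor, Real.rpow_sub two_pos, Real.rpow_one]
    change _ * ∫ t, ‖constIntegrand μ ν t‖ = _
    generalize ∫ t, ‖constIntegrand μ ν t‖ = J
    field_simp
  rw [Phi, norm_smul, Real.norm_eq_abs, abs_of_pos (by positivity), hC]
  refine (mul_le_mul_of_nonneg_left hle (by positivity)).trans_eq ?_
  ring

theorem stronglyMeasurable_Phi {μ : ℂ} {ν : ℝ}
    (hν : ν ∈ Set.Ioo (-(1/2) : ℝ) (-μ.re)) {x : ℝ} (hx : 0 < x) :
    StronglyMeasurable fun τ => Phi μ ν τ x := by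
  obtain ⟨h1, h2⟩ := hν
  unfold Phi
  suffices h : StronglyMeasurable (Function.uncurry fun τ t : ℝ =>
      Kker μ τ ((ν : ℂ) + (t : ℂ) * Complex.I) *
        (x : ℂ) ^ (-((ν : ℂ) + (t : ℂ) * Complex.I))) from
    (h.integral_prod_right (ν := volume)).const_smul (1 / (2 * Real.pi))
  refine Continuous.stronglyMeasurable ?_
  have hx0 : (x : ℂ) ≠ 0 := Complex.ofReal_ne_zero.mpr hx.ne'
  unfold Function.uncurry Kker
  have hpow : Continuous fun p : ℝ × ℝ => (x : ℂ) ^ (-((ν : ℂ) + (p.2 : ℂ) * Complex.I)) :=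
    Continuous.const_cpow (by fun_prop) (Or.inl hx0)
  have hd1 : ∀ p : ℝ × ℝ, 0 < (1 + ((ν : ℂ) + (p.2 : ℂ) * Complex.I)).re := fun p => by
    simp; linarith
  have hd2 : ∀ p : ℝ × ℝ, 0 < (1 + ((ν : ℂ) + (p.2 : ℂ) * Complex.I) - μ).re := fun p => by
    simp; linarith
  refine Continuous.mul (Continuous.div (((Continuous.mul ?_ ?_).mul ?_).mul ?_)
    ((continuous_Gamma_comp (by fun_prop) hd1).mul (continuous_Gamma_comp (by fun_prop) hd2))
    fun p => mul_ne_zero (Complex.Gamma_ne_zero_of_re_pos (hd1 p))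
      (Complex.Gamma_ne_zero_of_re_pos (hd2 p))) hpow
  all_goals
    refine continuous_Gamma_comp (by fun_prop) fun p => ?_
    simp
    linarith

theorem stmt10 (μ : ℂ) (hμ : μ.re < 1/2) (ν : ℝ)
    (hν : ν ∈ Set.Ioo (-(1/2) : ℝ) (-μ.re))
    (g : ℝ → ℂ) (hg : Integrable g) :
    (∀ x : ℝ, 0 < x → Integrable fun τ : ℝ => Phi μ ν τ x * g τ) ∧
    (∀ x : ℝ, 0 < x →
      x ^ ν * ‖Gmu μ ν g x‖ ≤ Cconst μ ν * ∫ τ : ℝ, ‖g τ‖) := by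
  have hPhi := fun (x : ℝ) (hx : 0 < x) (τ : ℝ) => norm_Phi_le hν τ hx
  have hint : ∀ x : ℝ, 0 < x → Integrable fun τ : ℝ => Phi μ ν τ x * g τ := fun x hx =>
    hg.bdd_mul (stronglyMeasurable_Phi hν hx).aestronglyMeasurable
      (Filter.Eventually.of_forall (hPhi x hx))
  refine ⟨hint, fun x hx => ?_⟩
  have hle : ‖Gmu μ ν g x‖ ≤ ∫ τ, x ^ (-ν) * Cconst μ ν * ‖g τ‖ :=
    norm_integral_le_of_norm_le (hg.norm.const_mul _) (Filter.Eventually.of_forall fun τ => by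
      rw [norm_mul]
      exact mul_le_mul_of_nonneg_right (hPhi x hx τ) (norm_nonneg _))
  rw [integral_const_mul] at hle
  refine (mul_le_mul_of_nonneg_left hle (Real.rpow_nonneg hx.le ν)).trans_eq ?_
  rw [Real.rpow_neg hx.le]
  have := (Real.rpow_pos_of_pos hx ν).ne'
  field_simp
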